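/- There exists an absolute constant K > 0 with the following property. Let G be a finite simple graph with no isolated vertices and m ≥ 2 edges, let 0 < α ≤ 1/3, let p° : V → ℝ≥0 with ∑_v p°(v) = 1, and set p* = PR(α, p°). If there exist γ > 0 and a set S ⊆ V with p*(S) − vol(S)/(2m) ≥ γ, then there exists a nonempty set T ⊆ V with vol(T) ≤ m and Φ(T) ≤ K·sqrt(α·log₂ m / γ). -/

import Mathlib

open scoped Classical
open Finset

noncomputable section

variable {V : Type*} [Fintype V]

/-- The set of edges of `G` with exactly one endpoint in `S`. -/
def bdry (G : SimpleGraph V) (S : Finset V) : Finset (Sym2 V) :=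
  G.edgeFinset.filter fun e => ∃ u v, u ∈ S ∧ v ∉ S ∧ e = s(u, v)

/-- The volume of `S`: the sum of the degrees of the vertices of `S`. -/
def vol (G : SimpleGraph V) (S : Finset V) : ℕ := ∑ v ∈ S, G.degree v

/-- The conductance `Φ(S) = |∂S| / min(vol S, 2m − vol S)`. -/
def conduct (G : SimpleGraph V) (S : Finset V) : ℝ :=
  ((bdry G S).card : ℝ) /
    ((min (vol G S) (2 * G.edgeFinset.card - vol G S) : ℕ) : ℝ)

/-- The lazy random walk operator: `(W q)(v) = q(v)/2 + ∑_{u ~ v} q(u)/(2 d(u))`. -/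
def lazyWalk (G : SimpleGraph V) (q : V → ℝ) : V → ℝ := fun v =>
  q v / 2 + ∑ u ∈ G.neighborFinset v, q u / (2 * (G.degree u : ℝ))

/-- The PageRank limit distribution `PR(α, p°) = α ∑_{k≥0} (1−α)^k (p° W^k)`. -/
def PR (G : SimpleGraph V) (α : ℝ) (p0 : V → ℝ) : V → ℝ := fun v =>
  α * ∑' k : ℕ, (1 - α) ^ k * (lazyWalk G)^[k] p0 v

/-- Discrete coarea inequality: isoperimetry for sets of volume at most `M` gives an
`ℓ¹` Sobolev inequality for nonnegative functions whose support has volume at most `M`. -/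
theorem coarea_le (w : V → V → ℝ) (d : V → ℝ) (hd : ∀ u, 0 ≤ d u) (M c : ℝ)
    (hcut : ∀ T : Finset V, T.Nonempty → ∑ u ∈ T, d u ≤ M →
      c * ∑ u ∈ T, d u ≤
        ∑ u, ∑ v, w u v * |(if u ∈ T then (1 : ℝ) else 0) - (if v ∈ T then 1 else 0)|)
    (F : V → ℝ) (hF : ∀ u, 0 ≤ F u)
    (hM : ∑ u ∈ univ.filter (fun u => 0 < F u), d u ≤ M) :
    c * ∑ u, d u * F u ≤ ∑ u, ∑ v, w u v * |F u - F v| := by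
  induction hn : (univ.filter (fun u => 0 < F u)).card using Nat.strong_induction_on
    generalizing F with
  | _ n ih =>
  set T := univ.filter (fun u => 0 < F u) with hT
  rcases T.eq_empty_or_nonempty with h0 | hne
  · have hz : ∀ u, F u = 0 := by
      intro u
      by_contra h
      have : u ∈ T := by simp [hT, lt_of_le_of_ne (hF u) (Ne.symm h)]
      simp [h0] at this
    simp [hz]
  · obtain ⟨x, hxT, hx⟩ := T.exists_min_image F hne
    have hx0 : 0 < F x := by simpa [hT] using hxT
    have hTm : ∀ u, u ∈ T ↔ 0 < F u := fun u => by simp [hT]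
    have hFz : ∀ u, u ∉ T → F u = 0 := fun u hu =>
      le_antisymm (not_lt.mp (fun h => hu ((hTm u).2 h))) (hF u)
    let F' : V → ℝ := fun u => F u - F x * (if u ∈ T then 1 else 0)
    have hF' : ∀ u, 0 ≤ F' u := by
      intro u
      by_cases hu : u ∈ T
      · simpa [F', hu] using hx u hu
      · simp [F', hu, hF u]
    have hsub : univ.filter (fun u => 0 < F' u) ⊂ T := by
      refine (Finset.ssubset_iff_of_subset ?_).2 ⟨x, hxT, by simp [F', hxT]⟩
      intro u hu
      by_contra h
      simp [F', h, hFz u h] at hu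
    have key := ih _ (hn ▸ Finset.card_lt_card hsub) F' hF'
      ((Finset.sum_le_sum_of_subset_of_nonneg hsub.1 (fun i _ _ => hd i)).trans hM) rfl
    have hc := mul_le_mul_of_nonneg_left (hcut T hne hM) hx0.le
    have e1 : ∑ u, d u * F u = ∑ u, d u * F' u + F x * ∑ u ∈ T, d u := by
      rw [← Finset.sum_filter_add_sum_filter_not univ (· ∈ T) (fun u => d u * F u),
        ← Finset.sum_filter_add_sum_filter_not univ (· ∈ T) (fun u => d u * F' u)]
      have a1 : ∑ u ∈ univ.filter (· ∈ T), d u * F' u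
          = ∑ u ∈ univ.filter (· ∈ T), d u * F u - F x * ∑ u ∈ T, d u := by
        rw [Finset.mul_sum, show univ.filter (· ∈ T) = T by ext; simp, ← Finset.sum_sub_distrib]
        refine Finset.sum_congr rfl fun u hu => ?_
        simp [F', hu]; ring
      have a2 : ∑ u ∈ univ.filter (· ∉ T), d u * F' u = ∑ u ∈ univ.filter (· ∉ T), d u * F u := by
        refine Finset.sum_congr rfl fun u hu => ?_
        have : u ∉ T := by simpa using hu
        simp [F', this]
      rw [a1, a2]; ring
    have e2 : ∑ u, ∑ v, w u v * |F u - F v| = ∑ u, ∑ v, w u v * |F' u - F' v| +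
        F x * ∑ u, ∑ v, w u v *
          |(if u ∈ T then (1 : ℝ) else 0) - (if v ∈ T then 1 else 0)| := by
      simp only [Finset.mul_sum, ← Finset.sum_add_distrib]
      refine Finset.sum_congr rfl fun u _ => Finset.sum_congr rfl fun v _ => ?_
      by_cases hu : u ∈ T <;> by_cases hv : v ∈ T
      · simp [F', hu, hv]
      · have := hx u hu
        simp only [F', hu, hv, hFz v hv, if_true, if_false]
        rw [abs_of_nonneg, abs_of_nonneg, abs_of_nonneg] <;> linarith
      · have := hx v hv
        simp only [F', hu, hv, hFz u hu, if_true, if_false]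
        rw [abs_of_nonpos, abs_of_nonpos, abs_of_nonpos] <;> linarith
      · simp [F', hu, hv]
    rw [e1, e2]
    linarith

/-- A symmetric weight and a function of one endpoint: both ways of summing agree. -/
theorem sum_weight_add (w : V → V → ℝ) (hs : ∀ u v, w u v = w v u) (F : V → ℝ) :
    ∑ u, ∑ v, w u v * (F u + F v) = 2 * ∑ u, (∑ v, w u v) * F u := by
  have h1 : ∑ u, ∑ v, w u v * F v = ∑ u, ∑ v, w u v * F u := by
    rw [Finset.sum_comm]
    exact Finset.sum_congr rfl fun u _ => Finset.sum_congr rfl fun v _ => by rw [hs]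
  simp only [mul_add, Finset.sum_add_distrib, h1, Finset.sum_mul]
  ring

/-- Dirichlet-type Cheeger inequality for a nonnegative function of small support. -/
theorem cheeger_of_support (w : V → V → ℝ) (hw : ∀ u v, 0 ≤ w u v)
    (hs : ∀ u v, w u v = w v u) (M φ : ℝ) (hφ : 0 < φ)
    (hcut : ∀ T : Finset V, T.Nonempty → ∑ u ∈ T, ∑ v, w u v ≤ M →
      2 * φ * ∑ u ∈ T, ∑ v, w u v ≤
        ∑ u, ∑ v, w u v * |(if u ∈ T then (1 : ℝ) else 0) - (if v ∈ T then 1 else 0)|)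
    (g : V → ℝ) (hg : ∀ u, 0 ≤ g u)
    (hM : ∑ u ∈ univ.filter (fun u => 0 < g u), ∑ v, w u v ≤ M) :
    φ ^ 2 * ∑ u, (∑ v, w u v) * g u ^ 2 ≤ ∑ u, ∑ v, w u v * (g u - g v) ^ 2 := by
  have h := coarea_le w (fun u => ∑ v, w u v) (fun u => Finset.sum_nonneg fun v _ => hw u v)
    M (2 * φ) hcut (fun u => g u ^ 2) (fun u => sq_nonneg _) (by
      refine le_trans (le_of_eq ?_) hM
      congr 1
      ext u
      simp only [Finset.mem_filter, Finset.mem_univ, true_and]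
      exact ⟨fun h => lt_of_le_of_ne (hg u) (fun h0 => by rw [← h0] at h; simp at h),
        fun h => by positivity⟩)
  have h2 : φ * ∑ u, ∑ v, w u v * |g u ^ 2 - g v ^ 2| ≤
      ∑ u, ∑ v, w u v * (g u - g v) ^ 2 +
        φ ^ 2 / 2 * ∑ u, ∑ v, w u v * (g u ^ 2 + g v ^ 2) := by
    simp only [Finset.mul_sum, ← Finset.sum_add_distrib]
    refine Finset.sum_le_sum fun u _ => Finset.sum_le_sum fun v _ => ?_
    have : φ * |g u ^ 2 - g v ^ 2| ≤
        (g u - g v) ^ 2 + φ ^ 2 / 2 * (g u ^ 2 + g v ^ 2) := by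
      rw [sq_sub_sq, abs_mul, abs_of_nonneg (add_nonneg (hg u) (hg v)), ← sq_abs (g u - g v)]
      nlinarith [sq_nonneg (|g u - g v| - φ / 2 * (g u + g v)), sq_nonneg (φ * (g u - g v))]
    nlinarith [mul_le_mul_of_nonneg_left this (hw u v)]
  rw [sum_weight_add w hs (fun u => g u ^ 2)] at h2
  nlinarith [mul_le_mul_of_nonneg_left h hφ.le]

/-- Existence of a weighted median. -/
theorem exists_median [Nonempty V] (d : V → ℝ) (hd : ∀ u, 0 ≤ d u) (M : ℝ)
    (hM : ∑ u, d u = 2 * M) (f : V → ℝ) :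
    ∃ c, ∑ u ∈ univ.filter (fun u => c < f u), d u ≤ M ∧
      ∑ u ∈ univ.filter (fun u => f u < c), d u ≤ M := by
  have hM0 : 0 ≤ M := by
    have := Finset.sum_nonneg fun (u : V) (_ : u ∈ univ) => hd u
    linarith
  set A := univ.filter (fun x : V => ∑ u ∈ univ.filter (fun u => f x < f u), d u ≤ M) with hA
  have hAne : A.Nonempty := by
    obtain ⟨x, -, hx⟩ := Finset.exists_max_image univ f univ_nonempty
    refine ⟨x, ?_⟩
    have : univ.filter (fun u => f x < f u) = ∅ := by
      ext u; simpa using hx u (mem_univ _)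
    simp [hA, this, hM0]
  obtain ⟨x, hxA, hx⟩ := A.exists_min_image f hAne
  refine ⟨f x, by simpa [hA] using hxA, ?_⟩
  rcases (univ.filter (fun u => f u < f x)).eq_empty_or_nonempty with h0 | hne
  · simp [h0, hM0]
  · obtain ⟨y, hy, hym⟩ := Finset.exists_max_image _ f hne
    have hyx : f y < f x := by simpa using hy
    have hyA : y ∉ A := fun h => absurd (hx y h) (not_le.mpr hyx)
    have hyM : M < ∑ u ∈ univ.filter (fun u => f y < f u), d u := by simpa [hA] using hyA
    have hle : ∑ u ∈ univ.filter (fun u => f y < f u), d u ≤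
        ∑ u ∈ univ.filter (fun u => ¬ f u < f x), d u := by
      refine Finset.sum_le_sum_of_subset_of_nonneg (fun u hu => ?_) (fun u _ _ => hd u)
      simp only [mem_filter, mem_univ, true_and] at hu ⊢
      intro h
      exact absurd (hym u (by simpa using h)) (not_le.mpr hu)
    have := Finset.sum_filter_add_sum_filter_not univ (fun u => f u < f x) d
    linarith

/-- Cheeger's inequality for a symmetric weight of total mass `2 * M`. -/
theorem cheeger [Nonempty V] (w : V → V → ℝ) (hw : ∀ u v, 0 ≤ w u v)
    (hs : ∀ u v, w u v = w v u) (M φ : ℝ) (hφ : 0 < φ) (htot : ∑ u, ∑ v, w u v = 2 * M)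
    (hcut : ∀ T : Finset V, T.Nonempty → ∑ u ∈ T, ∑ v, w u v ≤ M →
      2 * φ * ∑ u ∈ T, ∑ v, w u v ≤
        ∑ u, ∑ v, w u v * |(if u ∈ T then (1 : ℝ) else 0) - (if v ∈ T then 1 else 0)|)
    (f : V → ℝ) (hf : ∑ u, (∑ v, w u v) * f u = 0) :
    φ ^ 2 * ∑ u, (∑ v, w u v) * f u ^ 2 ≤ ∑ u, ∑ v, w u v * (f u - f v) ^ 2 := by
  have hd : ∀ u, 0 ≤ ∑ v, w u v := fun u => Finset.sum_nonneg fun v _ => hw u v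
  obtain ⟨c, hc1, hc2⟩ := exists_median (fun u => ∑ v, w u v) hd M htot f
  have hg := cheeger_of_support w hw hs M φ hφ hcut (fun u => max (f u - c) 0)
    (fun u => le_max_right _ _) (by simpa using hc1)
  have hh := cheeger_of_support w hw hs M φ hφ hcut (fun u => max (c - f u) 0)
    (fun u => le_max_right _ _) (by simpa using hc2)
  have hE : ∑ u, ∑ v, w u v * (max (f u - c) 0 - max (f v - c) 0) ^ 2 +
      ∑ u, ∑ v, w u v * (max (c - f u) 0 - max (c - f v) 0) ^ 2 ≤
      ∑ u, ∑ v, w u v * (f u - f v) ^ 2 := by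
    simp only [← Finset.sum_add_distrib, ← mul_add]
    refine Finset.sum_le_sum fun u _ => Finset.sum_le_sum fun v _ =>
      mul_le_mul_of_nonneg_left ?_ (hw u v)
    rcases le_total (f u) c with h1 | h1 <;> rcases le_total (f v) c with h2 | h2
    · rw [max_eq_right (by linarith), max_eq_right (by linarith), max_eq_left (by linarith),
        max_eq_left (by linarith)]
      nlinarith
    · rw [max_eq_right (by linarith), max_eq_left (by linarith), max_eq_left (by linarith),
        max_eq_right (by linarith)]
      nlinarith [mul_nonneg (sub_nonneg.2 h1) (sub_nonneg.2 h2)]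
    · rw [max_eq_left (by linarith), max_eq_right (by linarith), max_eq_right (by linarith),
        max_eq_left (by linarith)]
      nlinarith [mul_nonneg (sub_nonneg.2 h1) (sub_nonneg.2 h2)]
    · rw [max_eq_left (by linarith), max_eq_left (by linarith), max_eq_right (by linarith),
        max_eq_right (by linarith)]
      nlinarith
  have hN : ∑ u, (∑ v, w u v) * max (f u - c) 0 ^ 2 + ∑ u, (∑ v, w u v) * max (c - f u) 0 ^ 2 =
      ∑ u, (∑ v, w u v) * f u ^ 2 + c ^ 2 * (2 * M) := by
    have e : ∑ u, (∑ v, w u v) * max (f u - c) 0 ^ 2 +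
        ∑ u, (∑ v, w u v) * max (c - f u) 0 ^ 2 =
        ∑ u, (∑ v, w u v) * f u ^ 2 + c ^ 2 * ∑ u, ∑ v, w u v
          - 2 * c * ∑ u, (∑ v, w u v) * f u := by
      rw [Finset.mul_sum (f := fun u => ∑ v, w u v),
        Finset.mul_sum (f := fun u => (∑ v, w u v) * f u), ← Finset.sum_add_distrib,
        ← Finset.sum_add_distrib, ← Finset.sum_sub_distrib]
      refine Finset.sum_congr rfl fun u _ => ?_
      rcases le_total (f u) c with h1 | h1
      · rw [max_eq_right (by linarith), max_eq_left (by linarith)]; ring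
      · rw [max_eq_left (by linarith), max_eq_right (by linarith)]; ring
    rw [e, hf, htot]; ring
  have hM0 : 0 ≤ 2 * M := htot ▸ Finset.sum_nonneg fun u _ => hd u
  nlinarith [mul_nonneg (sq_nonneg φ) (mul_nonneg (sq_nonneg c) hM0)]

/-- One lazy averaging step decreases the weighted `ℓ²` norm by a quarter of the Dirichlet
energy. -/
theorem lazy_step_energy (w : V → V → ℝ) (hw : ∀ u v, 0 ≤ w u v)
    (hs : ∀ u v, w u v = w v u) (f f' : V → ℝ)
    (hf' : ∀ v, (∑ u, w v u) * f' v = ∑ u, w v u * ((f v + f u) / 2)) :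
    ∑ u, (∑ v, w u v) * f' u ^ 2 ≤
      ∑ u, (∑ v, w u v) * f u ^ 2 - (∑ u, ∑ v, w u v * (f u - f v) ^ 2) / 4 := by
  have h1 : ∀ u, (∑ v, w u v) * f' u ^ 2 ≤ ∑ v, w u v * ((f u + f v) / 2) ^ 2 := by
    intro u
    have h0 : 0 ≤ ∑ v, w u v * ((f u + f v) / 2 - f' u) ^ 2 :=
      Finset.sum_nonneg fun v _ => mul_nonneg (hw u v) (sq_nonneg _)
    have e : ∑ v, w u v * ((f u + f v) / 2 - f' u) ^ 2 =
        ∑ v, w u v * ((f u + f v) / 2) ^ 2 - 2 * f' u * ∑ v, w u v * ((f u + f v) / 2)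
          + f' u ^ 2 * ∑ v, w u v := by
      simp only [Finset.mul_sum, ← Finset.sum_add_distrib, ← Finset.sum_sub_distrib]
      exact Finset.sum_congr rfl fun v _ => by ring
    rw [e, ← hf' u] at h0
    nlinarith
  have h2 := sum_weight_add w hs (fun u => f u ^ 2)
  have h3 : ∑ u, ∑ v, w u v * ((f u + f v) / 2) ^ 2 =
      (∑ u, ∑ v, w u v * (f u ^ 2 + f v ^ 2)) / 2 -
        (∑ u, ∑ v, w u v * (f u - f v) ^ 2) / 4 := by
    simp only [Finset.sum_div, ← Finset.sum_sub_distrib]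
    exact Finset.sum_congr rfl fun u _ => Finset.sum_congr rfl fun v _ => by ring
  have h4 := Finset.sum_le_sum fun (u : V) (_ : u ∈ univ) => h1 u
  linarith

/-- The adjacency weight of `G`. -/
def adjWeight (G : SimpleGraph V) (u v : V) : ℝ := if G.Adj u v then 1 else 0

theorem adjWeight_nonneg {U : Type*} (G : SimpleGraph U) (u v : U) : 0 ≤ adjWeight G u v := by
  unfold adjWeight; split_ifs <;> norm_num

theorem adjWeight_comm {U : Type*} (G : SimpleGraph U) (u v : U) :
    adjWeight G u v = adjWeight G v u := by
  simp [adjWeight, G.adj_comm]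

theorem sum_adjWeight_mul (G : SimpleGraph V) (u : V) (F : V → ℝ) :
    ∑ v, adjWeight G u v * F v = ∑ v ∈ G.neighborFinset u, F v := by
  simp only [adjWeight, ite_mul, one_mul, zero_mul]
  rw [← Finset.sum_filter]
  congr 1
  ext v; simp

theorem sum_adjWeight (G : SimpleGraph V) (u : V) : ∑ v, adjWeight G u v = G.degree u := by
  simpa using sum_adjWeight_mul G u (fun _ => 1)

theorem two_mul_card_bdry_le (G : SimpleGraph V) (T : Finset V) :
    2 * ((bdry G T).card : ℝ) ≤ ∑ u, ∑ v, adjWeight G u v *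
      |(if u ∈ T then (1 : ℝ) else 0) - (if v ∈ T then 1 else 0)| := by
  set P := (univ : Finset (V × V)).filter fun p => G.Adj p.1 p.2 ∧ p.1 ∈ T ∧ p.2 ∉ T with hP
  have hcard : (bdry G T).card ≤ P.card := by
    refine (Finset.card_le_card ?_).trans (Finset.card_image_le (s := P) (f := fun p => s(p.1, p.2)))
    intro e he
    simp only [bdry, mem_filter] at he
    obtain ⟨he, u, v, hu, hv, rfl⟩ := he
    refine Finset.mem_image.2 ⟨(u, v), ?_, rfl⟩
    simpa [hP, hu, hv] using he
  have hPs : (P.card : ℝ) = ∑ u, ∑ v, if G.Adj u v ∧ u ∈ T ∧ v ∉ T then (1 : ℝ) else 0 := by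
    rw [hP, Finset.card_filter, ← Fintype.sum_prod_type']
    push_cast
    rfl
  have hPs' : (P.card : ℝ) = ∑ u, ∑ v, if G.Adj u v ∧ v ∈ T ∧ u ∉ T then (1 : ℝ) else 0 := by
    rw [hPs, Finset.sum_comm]
    simp only [G.adj_comm]
  have hsum : ∑ u, ∑ v, adjWeight G u v *
      |(if u ∈ T then (1 : ℝ) else 0) - (if v ∈ T then 1 else 0)| = P.card + P.card := by
    nth_rewrite 1 [hPs]
    rw [hPs']
    simp only [← Finset.sum_add_distrib]
    refine Finset.sum_congr rfl fun u _ => Finset.sum_congr rfl fun v _ => ?_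
    by_cases h : G.Adj u v <;> by_cases hu : u ∈ T <;> by_cases hv : v ∈ T <;>
      simp [adjWeight, h, hu, hv]
  have : ((bdry G T).card : ℝ) ≤ P.card := by exact_mod_cast hcard
  linarith

theorem card_bdry_singleton_le (G : SimpleGraph V) (v : V) :
    (bdry G {v}).card ≤ G.degree v := by
  rw [← G.card_incidenceFinset_eq_degree]
  refine Finset.card_le_card fun e he => ?_
  simp only [bdry, mem_filter] at he
  obtain ⟨he, a, b, ha, -, rfl⟩ := he
  rw [Finset.mem_singleton] at ha
  subst ha
  simpa using he

theorem lazyWalk_nonneg (G : SimpleGraph V) (q : V → ℝ) (hq : ∀ v, 0 ≤ q v) (v : V) :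
    0 ≤ lazyWalk G q v := by
  unfold lazyWalk
  have := Finset.sum_nonneg fun (u : V) (_ : u ∈ G.neighborFinset v) =>
    div_nonneg (hq u) (by positivity : (0 : ℝ) ≤ 2 * (G.degree u : ℝ))
  have := hq v
  linarith

theorem sum_lazyWalk (G : SimpleGraph V) (hdeg : ∀ v, 0 < G.degree v) (q : V → ℝ) :
    ∑ v, lazyWalk G q v = ∑ v, q v := by
  have h : ∑ v, ∑ u ∈ G.neighborFinset v, q u / (2 * (G.degree u : ℝ)) = ∑ v, q v / 2 := by
    simp only [← sum_adjWeight_mul]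
    rw [Finset.sum_comm]
    refine Finset.sum_congr rfl fun u _ => ?_
    rw [← Finset.sum_mul]
    simp only [adjWeight_comm G _ u]
    rw [sum_adjWeight]
    have : (G.degree u : ℝ) ≠ 0 := by exact_mod_cast (hdeg u).ne'
    field_simp
  simp only [lazyWalk]
  rw [Finset.sum_add_distrib, h, ← Finset.sum_add_distrib]
  exact Finset.sum_congr rfl fun v _ => by ring

theorem iterate_lazyWalk_nonneg (G : SimpleGraph V) (q : V → ℝ) (hq : ∀ v, 0 ≤ q v) (k : ℕ)
    (v : V) : 0 ≤ (lazyWalk G)^[k] q v := by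
  induction k generalizing v with
  | zero => exact hq v
  | succ k ih => rw [Function.iterate_succ_apply']; exact lazyWalk_nonneg G _ ih v

theorem sum_iterate_lazyWalk (G : SimpleGraph V) (hdeg : ∀ v, 0 < G.degree v) (q : V → ℝ)
    (k : ℕ) : ∑ v, (lazyWalk G)^[k] q v = ∑ v, q v := by
  induction k with
  | zero => rfl
  | succ k ih => rw [Function.iterate_succ_apply', sum_lazyWalk G hdeg, ih]

/-- The squared `ℓ²(1/d)` distance of `q` from the stationary distribution. -/
def statDist (G : SimpleGraph V) (m : ℕ) (q : V → ℝ) : ℝ :=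
  ∑ v, (G.degree v : ℝ) * (q v / G.degree v - 1 / (2 * (m : ℝ))) ^ 2

theorem statDist_lazyWalk_le [Nonempty V] (G : SimpleGraph V) (m : ℕ)
    (hm : m = G.edgeFinset.card) (hm2 : 2 ≤ m) (hdeg : ∀ v, 0 < G.degree v)
    (φ : ℝ) (hφ : 0 < φ)
    (hcut : ∀ T : Finset V, T.Nonempty → vol G T ≤ m → φ * vol G T ≤ (bdry G T).card)
    (q : V → ℝ) (hq : ∑ v, q v = 1) :
    statDist G m (lazyWalk G q) ≤ (1 - φ ^ 2 / 4) * statDist G m q := by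
  have hm0 : (m : ℝ) ≠ 0 := by positivity
  have htotn : ∑ u, (G.degree u : ℝ) = 2 * m := by
    have := G.sum_degrees_eq_twice_card_edges
    rw [hm]; exact_mod_cast this
  have hd0 : ∀ v, (G.degree v : ℝ) ≠ 0 := fun v => by exact_mod_cast (hdeg v).ne'
  have hch := cheeger (adjWeight G) (adjWeight_nonneg G) (adjWeight_comm G) m φ hφ
    (by simpa only [sum_adjWeight] using htotn)
    (fun T hT hTM => by
      simp only [sum_adjWeight] at hTM ⊢
      have h1 : vol G T ≤ m := by unfold vol; exact_mod_cast hTM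
      have h2 := hcut T hT h1
      have h3 := two_mul_card_bdry_le G T
      unfold vol at h2
      push_cast at h2
      linarith)
    (fun v => q v / G.degree v - 1 / (2 * (m : ℝ)))
    (by
      simp only [sum_adjWeight, mul_sub, Finset.sum_sub_distrib]
      rw [← Finset.sum_mul, htotn]
      have : ∑ u, (G.degree u : ℝ) * (q u / G.degree u) = 1 := by
        rw [← hq]
        exact Finset.sum_congr rfl fun u _ => mul_div_cancel₀ _ (hd0 u)
      rw [this]
      field_simp
      ring)
  have hst := lazy_step_energy (adjWeight G) (adjWeight_nonneg G) (adjWeight_comm G)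
    (fun v => q v / G.degree v - 1 / (2 * (m : ℝ)))
    (fun v => lazyWalk G q v / G.degree v - 1 / (2 * (m : ℝ)))
    (by
      intro v
      have e : ∑ u, adjWeight G v u * ((q v / G.degree v - 1 / (2 * (m : ℝ)) +
          (q u / G.degree u - 1 / (2 * (m : ℝ)))) / 2) =
          (∑ u, adjWeight G v u) * (q v / G.degree v / 2 - 1 / (2 * (m : ℝ))) +
            ∑ u, adjWeight G v u * (q u / (2 * (G.degree u : ℝ))) := by
        rw [Finset.sum_mul, ← Finset.sum_add_distrib]
        refine Finset.sum_congr rfl fun u _ => ?_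
        have := hd0 u
        field_simp
        ring
      rw [e, sum_adjWeight, sum_adjWeight_mul]
      unfold lazyWalk
      have := hd0 v
      field_simp
      ring)
  simp only [sum_adjWeight] at hch hst
  unfold statDist
  linarith

theorem statDist_le_one (G : SimpleGraph V) (m : ℕ)
    (hm : m = G.edgeFinset.card) (hm2 : 2 ≤ m) (hdeg : ∀ v, 0 < G.degree v)
    (q : V → ℝ) (hq0 : ∀ v, 0 ≤ q v) (hq : ∑ v, q v = 1) : statDist G m q ≤ 1 := by
  have hm0 : (0 : ℝ) < m := by positivity
  have htotn : ∑ u, (G.degree u : ℝ) = 2 * m := by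
    have := G.sum_degrees_eq_twice_card_edges
    rw [hm]; exact_mod_cast this
  have h1 : ∀ v, (G.degree v : ℝ) * (q v / G.degree v - 1 / (2 * (m : ℝ))) ^ 2 ≤
      q v - 1 / m * q v + (1 / (2 * (m : ℝ))) ^ 2 * G.degree v := by
    intro v
    have hd1 : (1 : ℝ) ≤ G.degree v := by exact_mod_cast hdeg v
    have hd0 : (G.degree v : ℝ) ≠ 0 := by positivity
    have hqv : q v ≤ 1 := hq ▸ Finset.single_le_sum (fun u _ => hq0 u) (mem_univ v)
    have e : (G.degree v : ℝ) * (q v / G.degree v - 1 / (2 * (m : ℝ))) ^ 2 =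
        q v ^ 2 / G.degree v - 1 / m * q v + (1 / (2 * (m : ℝ))) ^ 2 * G.degree v := by
      field_simp
      ring
    have : q v ^ 2 / G.degree v ≤ q v := by
      rw [div_le_iff₀ (by positivity)]
      nlinarith [hq0 v]
    linarith
  have h2 := Finset.sum_le_sum fun (v : V) (_ : v ∈ univ) => h1 v
  rw [Finset.sum_add_distrib, Finset.sum_sub_distrib, ← Finset.mul_sum, ← Finset.mul_sum, hq,
    htotn] at h2
  have e : (1 : ℝ) - 1 / m * 1 + (1 / (2 * (m : ℝ))) ^ 2 * (2 * m) = 1 - 1 / (2 * m) := by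
    field_simp
    ring
  have : (0 : ℝ) ≤ 1 / (2 * m) := by positivity
  unfold statDist
  linarith

/-- Mixing estimate: the excess mass on any set decays geometrically. -/
theorem excess_le [Nonempty V] (G : SimpleGraph V) (m : ℕ)
    (hm : m = G.edgeFinset.card) (hm2 : 2 ≤ m) (hdeg : ∀ v, 0 < G.degree v)
    (φ : ℝ) (hφ : 0 < φ) (hφ1 : φ ≤ 1)
    (hcut : ∀ T : Finset V, T.Nonempty → vol G T ≤ m → φ * vol G T ≤ (bdry G T).card)
    (q : V → ℝ) (hq0 : ∀ v, 0 ≤ q v) (hq : ∑ v, q v = 1) (S : Finset V) (k : ℕ) :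
    ∑ v ∈ S, (lazyWalk G)^[k] q v - (vol G S : ℝ) / (2 * (m : ℝ)) ≤
      m * (1 - φ ^ 2 / 8) ^ k := by
  have hφ2 : φ ^ 2 ≤ 1 := pow_le_one₀ hφ.le hφ1
  have hD : ∀ k, statDist G m ((lazyWalk G)^[k] q) ≤ (1 - φ ^ 2 / 4) ^ k := by
    intro k
    induction k with
    | zero => simpa using statDist_le_one G m hm hm2 hdeg q hq0 hq
    | succ k ih =>
      rw [Function.iterate_succ_apply', pow_succ']
      exact (statDist_lazyWalk_le G m hm hm2 hdeg φ hφ hcut _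
        ((sum_iterate_lazyWalk G hdeg q k).trans hq)).trans
        (mul_le_mul_of_nonneg_left ih (by linarith))
  have hD2 : (1 - φ ^ 2 / 4) ^ k ≤ ((1 - φ ^ 2 / 8) ^ k) ^ 2 := by
    rw [← pow_mul, mul_comm k, pow_mul]
    exact pow_le_pow_left₀ (by linarith) (by nlinarith [sq_nonneg (φ ^ 2)]) k
  have htotn : ∑ u, (G.degree u : ℝ) = 2 * m := by
    have := G.sum_degrees_eq_twice_card_edges
    rw [hm]; exact_mod_cast this
  set p := (lazyWalk G)^[k] q with hp
  have hx : ∑ v ∈ S, p v - (vol G S : ℝ) / (2 * (m : ℝ)) =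
      ∑ v ∈ S, √(G.degree v : ℝ) *
        (√(G.degree v : ℝ) * (p v / G.degree v - 1 / (2 * (m : ℝ)))) := by
    unfold vol
    push_cast
    rw [Finset.sum_div, ← Finset.sum_sub_distrib]
    refine Finset.sum_congr rfl fun v _ => ?_
    have : (G.degree v : ℝ) ≠ 0 := by exact_mod_cast (hdeg v).ne'
    rw [← mul_assoc, Real.mul_self_sqrt (by positivity)]
    field_simp
  have hcs := Finset.sum_mul_sq_le_sq_mul_sq S (fun v => √(G.degree v : ℝ))
    (fun v => √(G.degree v : ℝ) * (p v / G.degree v - 1 / (2 * (m : ℝ))))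
  rw [← hx] at hcs
  simp only [mul_pow, Real.sq_sqrt (Nat.cast_nonneg (α := ℝ) _)] at hcs
  have hS1 : ∑ v ∈ S, (G.degree v : ℝ) ≤ 2 * m :=
    htotn ▸ Finset.sum_le_sum_of_subset_of_nonneg (subset_univ S) (fun _ _ _ => by positivity)
  have hS2 : ∑ v ∈ S, (G.degree v : ℝ) * (p v / G.degree v - 1 / (2 * (m : ℝ))) ^ 2 ≤
      ((1 - φ ^ 2 / 8) ^ k) ^ 2 :=
    (Finset.sum_le_sum_of_subset_of_nonneg (subset_univ S)
      (fun _ _ _ => by positivity)).trans ((hD k).trans hD2)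
  have hm2' : (2 : ℝ) ≤ m := by exact_mod_cast hm2
  have hr : (0 : ℝ) ≤ 1 - φ ^ 2 / 8 := by linarith
  refine le_of_sq_le_sq ?_ (by positivity)
  calc _ ≤ _ := hcs
    _ ≤ (2 * m) * ((1 - φ ^ 2 / 8) ^ k) ^ 2 :=
      mul_le_mul hS1 hS2 (Finset.sum_nonneg fun _ _ => by positivity) (by positivity)
    _ ≤ (m * (1 - φ ^ 2 / 8) ^ k) ^ 2 := by
      rw [mul_pow]
      exact mul_le_mul_of_nonneg_right (by nlinarith) (sq_nonneg _)

/-- A quantity bounded by `1` and by a geometric sequence with prefactor `m` is bounded by a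
geometric sequence with prefactor `2`, at the cost of dividing the rate by `log₂ m`. -/
theorem le_two_mul_pow_of_le (m : ℕ) (hm : 2 ≤ m) (δ : ℝ) (hδ1 : δ ≤ 1)
    (x : ℝ) (k : ℕ) (hx1 : x ≤ 1) (hx : x ≤ m * (1 - δ) ^ k) :
    x ≤ 2 * (1 - δ / Real.logb 2 m) ^ k := by
  have hm' : (2 : ℝ) ≤ m := by exact_mod_cast hm
  have hL : 1 ≤ Real.logb 2 m := by
    rw [Real.le_logb_iff_rpow_le (by norm_num) (by linarith)]; simpa using hm'
  set L := Real.logb 2 m with hLdef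
  have hL0 : 0 < L := by linarith
  have hδL : δ / L ≤ 1 := by rw [div_le_one hL0]; linarith
  rcases le_or_gt x 0 with hx0 | hx0
  · exact hx0.trans (mul_nonneg (by norm_num) (pow_nonneg (by linarith) k))
  have hθ : 1 / L ≤ 1 := by rw [div_le_one hL0]; exact hL
  have hθ0 : 0 ≤ 1 / L := by positivity
  have hr0 : 0 ≤ 1 - δ := by linarith
  calc x = x ^ (1 : ℝ) := (Real.rpow_one x).symm
    _ ≤ x ^ (1 / L) := Real.rpow_le_rpow_of_exponent_ge hx0 hx1 hθ
    _ ≤ (m * (1 - δ) ^ k) ^ (1 / L) := Real.rpow_le_rpow hx0.le hx hθ0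
    _ = (m : ℝ) ^ (1 / L) * ((1 - δ) ^ (1 / L)) ^ k := by
      rw [Real.mul_rpow (by linarith) (by positivity), ← Real.rpow_natCast (1 - δ) k,
        ← Real.rpow_mul hr0, mul_comm (k : ℝ), Real.rpow_mul hr0, Real.rpow_natCast]
    _ = 2 * ((1 - δ) ^ (1 / L)) ^ k := by
      congr 1
      have : (m : ℝ) = 2 ^ L := by
        rw [hLdef, Real.rpow_logb (by norm_num) (by norm_num) (by linarith)]
      rw [this, ← Real.rpow_mul (by norm_num), mul_one_div_cancel hL0.ne', Real.rpow_one]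
    _ ≤ 2 * (1 - δ / L) ^ k := by
      refine mul_le_mul_of_nonneg_left (pow_le_pow_left₀ (by positivity) ?_ k) (by norm_num)
      have := rpow_one_add_le_one_add_mul_self (s := -δ) (by linarith) hθ0 hθ
      rw [← sub_eq_add_neg] at this
      refine this.trans (le_of_eq ?_)
      ring

theorem PR_excess_le [Nonempty V] (G : SimpleGraph V) (m : ℕ)
    (hm : m = G.edgeFinset.card) (hm2 : 2 ≤ m) (hdeg : ∀ v, 0 < G.degree v)
    (φ : ℝ) (hφ : 0 < φ) (hφ1 : φ ≤ 1)
    (hcut : ∀ T : Finset V, T.Nonempty → vol G T ≤ m → φ * vol G T ≤ (bdry G T).card)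
    (α : ℝ) (hα : 0 < α) (hα1 : α ≤ 1)
    (q : V → ℝ) (hq0 : ∀ v, 0 ≤ q v) (hq : ∑ v, q v = 1) (S : Finset V) :
    ∑ v ∈ S, PR G α q v - (vol G S : ℝ) / (2 * (m : ℝ)) ≤
      16 * α * Real.logb 2 m / φ ^ 2 := by
  have hm' : (2 : ℝ) ≤ m := by exact_mod_cast hm2
  have hL : 1 ≤ Real.logb 2 m := by
    rw [Real.le_logb_iff_rpow_le (by norm_num) (by linarith)]; simpa using hm'
  have hφ2 : φ ^ 2 ≤ 1 := pow_le_one₀ hφ.le hφ1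
  set p : ℕ → V → ℝ := fun k => (lazyWalk G)^[k] q with hp
  have hp0 : ∀ k v, 0 ≤ p k v := fun k v => iterate_lazyWalk_nonneg G q hq0 k v
  have hp1 : ∀ k (A : Finset V), ∑ v ∈ A, p k v ≤ 1 := fun k A =>
    (Finset.sum_le_sum_of_subset_of_nonneg (subset_univ A) (fun v _ _ => hp0 k v)).trans
      (((sum_iterate_lazyWalk G hdeg q k).trans hq).le)
  have hgeo : HasSum (fun k : ℕ => (1 - α) ^ k) α⁻¹ := by
    simpa using hasSum_geometric_of_lt_one (r := 1 - α) (by linarith) (by linarith)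
  have hsum : ∀ v, Summable fun k : ℕ => (1 - α) ^ k * p k v := fun v =>
    Summable.of_nonneg_of_le
      (fun k => mul_nonneg (pow_nonneg (by linarith) k) (hp0 k v))
      (fun k => mul_le_of_le_one_right (pow_nonneg (by linarith) k)
        (by simpa using hp1 k {v})) hgeo.summable
  have h1 : HasSum (fun k : ℕ => ∑ v ∈ S, (1 - α) ^ k * p k v)
      (∑ v ∈ S, ∑' k, (1 - α) ^ k * p k v) := hasSum_sum fun v _ => (hsum v).hasSum
  have h2 := (h1.sub (hgeo.mul_right ((vol G S : ℝ) / (2 * (m : ℝ))))).mul_left α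
  have hs : 0 < φ ^ 2 / 8 / Real.logb 2 m := by positivity
  have hs1 : φ ^ 2 / 8 / Real.logb 2 m ≤ 1 := by
    rw [div_le_one (by linarith)]; linarith
  have h3 := (hasSum_geometric_of_lt_one (r := 1 - φ ^ 2 / 8 / Real.logb 2 m)
    (by linarith) (by linarith)).mul_left (2 * α)
  have h4 := hasSum_le (fun k => ?_) h2 h3
  · refine le_trans (le_of_eq ?_) (h4.trans (le_of_eq ?_))
    · simp only [PR]
      rw [← Finset.mul_sum, mul_sub, ← mul_assoc α α⁻¹, mul_inv_cancel₀ hα.ne', one_mul]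
    · have : Real.logb 2 m ≠ 0 := by positivity
      rw [sub_sub_cancel]
      field_simp
      ring
  · have hvol : (0 : ℝ) ≤ (vol G S : ℝ) / (2 * (m : ℝ)) := by positivity
    have hx := le_two_mul_pow_of_le m hm2 (φ ^ 2 / 8) (by linarith) _ k
      (by linarith [hp1 k S])
      (excess_le G m hm hm2 hdeg φ hφ hφ1 hcut q hq0 hq S k)
    have hr0 : 0 ≤ (1 - α) ^ k := pow_nonneg (by linarith) k
    have hr1 : (1 - α) ^ k ≤ 1 := pow_le_one₀ (by linarith) (by linarith)
    have hpow : 0 ≤ (1 - φ ^ 2 / 8 / Real.logb 2 m) ^ k := pow_nonneg (by linarith) k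
    rw [← Finset.mul_sum, ← mul_sub, mul_comm 2 α, mul_assoc]
    refine mul_le_mul_of_nonneg_left ?_ hα.le
    exact (mul_le_mul_of_nonneg_left hx hr0).trans
      (mul_le_of_le_one_left (by positivity) hr1)

theorem stmt14 :
    ∃ K : ℝ, 0 < K ∧
      ∀ (V : Type) [Fintype V], ∀ (G : SimpleGraph V) (m : ℕ),
        m = G.edgeFinset.card → 2 ≤ m →
        (∀ v : V, 0 < G.degree v) →
        ∀ (α : ℝ), 0 < α → α ≤ 1 / 3 →
        ∀ (p0 : V → ℝ), (∀ v, 0 ≤ p0 v) → (∑ v, p0 v) = 1 →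
        ∀ (γ : ℝ), 0 < γ →
        ∀ (S : Finset V),
          γ ≤ (∑ v ∈ S, PR G α p0 v) - (vol G S : ℝ) / (2 * (m : ℝ)) →
          ∃ T : Finset V, T.Nonempty ∧ vol G T ≤ m ∧
            conduct G T ≤ K * Real.sqrt (α * Real.logb 2 (m : ℝ) / γ) := by
  refine ⟨5, by norm_num, ?_⟩
  intro V _ G m hm hm2 hdeg α hα hα3 p0 hp0 hp γ hγ S hS
  by_contra! hcon
  have hm' : (2 : ℝ) ≤ m := by exact_mod_cast hm2
  have hL : 1 ≤ Real.logb 2 m := by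
    rw [Real.le_logb_iff_rpow_le (by norm_num) (by linarith)]; simpa using hm'
  set φ := 5 * Real.sqrt (α * Real.logb 2 (m : ℝ) / γ) with hφdef
  have hpos : 0 < α * Real.logb 2 (m : ℝ) / γ := by positivity
  have hφ : 0 < φ := by positivity
  have hφsq : φ ^ 2 = 25 * (α * Real.logb 2 (m : ℝ) / γ) := by
    rw [hφdef, mul_pow, Real.sq_sqrt hpos.le]; norm_num
  have hne : Nonempty V := by
    by_contra h
    rw [not_nonempty_iff] at h
    simp at hp
  have hcut : ∀ T : Finset V, T.Nonempty → vol G T ≤ m → φ * vol G T ≤ (bdry G T).card := by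
    intro T hT hTm
    have h := hcon T hT hTm
    obtain ⟨x, hx⟩ := hT
    have hv : 0 < vol G T := (hdeg x).trans_le
      (Finset.single_le_sum (f := fun v => G.degree v) (fun _ _ => Nat.zero_le _) hx)
    rw [conduct, ← hm, min_eq_left (by omega), lt_div_iff₀ (by exact_mod_cast hv)] at h
    exact h.le
  have hφ1 : φ ≤ 1 := by
    obtain ⟨v⟩ := hne
    have hvol : vol G {v} = G.degree v := by simp [vol]
    have h := hcut {v} (singleton_nonempty v)
      (by rw [hvol, hm]; exact G.degree_le_card_edgeFinset v)
    have h2 : ((bdry G {v}).card : ℝ) ≤ G.degree v := by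
      exact_mod_cast card_bdry_singleton_le G v
    have h3 : (0 : ℝ) < G.degree v := by exact_mod_cast hdeg v
    rw [hvol] at h
    nlinarith
  have h := hS.trans (PR_excess_le G m hm hm2 hdeg φ hφ hφ1 hcut α hα (by linarith) p0 hp0 hp S)
  rw [hφsq, le_div_iff₀ (by positivity)] at h
  have e : γ * (25 * (α * Real.logb 2 (m : ℝ) / γ)) = 25 * (α * Real.logb 2 m) := by
    field_simp
  have : 0 < α * Real.logb 2 (m : ℝ) := by positivity
  nlinarith

end
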